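/- (Unconditional stability of the Crank–Nicolson scheme.) Let 0 < α < 1, 1 < β ≤ 2, μ_α ≥ 0 and μ_β < 0, and let m ≥ 2. With D = μ_α(A + Aᵀ) + μ_β(B + Bᵀ) and M = (I + D)^{-1}(I - D), every error vector propagated by the scheme does not grow: for every vector ℰ⁰ ∈ ℝ^{m-1} and every natural number n, ‖Mⁿ ℰ⁰‖ ≤ ‖ℰ⁰‖ in the Euclidean norm. -/

import Mathlib

/-- Grünwald–Letnikov coefficients: `g γ 0 = 1`, `g γ k = (1 - (γ+1)/k) * g γ (k-1)`. -/
noncomputable def g (γ : ℝ) : ℕ → ℝ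
  | 0 => 1
  | k + 1 => (1 - (γ + 1) / ((k : ℝ) + 1)) * g γ k

/-- WSGD coefficients: `w γ 0 = (γ/2) g γ 0`, `w γ k = (γ/2) g γ k + ((2-γ)/2) g γ (k-1)`. -/
noncomputable def w (γ : ℝ) : ℕ → ℝ
  | 0 => γ / 2 * g γ 0
  | k + 1 => γ / 2 * g γ (k + 1) + (2 - γ) / 2 * g γ k

/-- The `(m-1) × (m-1)` lower-Hessenberg Toeplitz matrix with entries
`w_{i-j+1}^{(γ)}` for `j ≤ i+1` (1-based indices) and `0` otherwise. -/
noncomputable def wsgdMatrix (γ : ℝ) (m : ℕ) : Matrix (Fin (m - 1)) (Fin (m - 1)) ℝ :=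
  fun i j => if (j : ℕ) ≤ (i : ℕ) + 1 then w γ ((i : ℕ) + 1 - (j : ℕ)) else 0

/-- The Crank–Nicolson matrix `D = μ_α (A + Aᵀ) + μ_β (B + Bᵀ)`. -/
noncomputable def matD (α β μα μβ : ℝ) (m : ℕ) : Matrix (Fin (m - 1)) (Fin (m - 1)) ℝ :=
  μα • (wsgdMatrix α m + Matrix.transpose (wsgdMatrix α m)) + μβ • (wsgdMatrix β m + Matrix.transpose (wsgdMatrix β m))

open Finset in
lemma row_nonneg (T : ℕ → ℝ) (hP : ∀ n, 0 ≤ T 0 / 2 + ∑ d ∈ range n, T (d + 1)) (i N : ℕ)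
    (hi : i < N) : 0 ≤ ∑ j ∈ range N, T ((i - j) + (j - i)) := by
  obtain ⟨r, rfl⟩ := Nat.exists_eq_add_of_lt hi
  have e : i + r + 1 = (i + 1) + r := by ring
  rw [e, sum_range_add]
  have h1 : ∑ j ∈ range (i + 1), T ((i - j) + (j - i)) = ∑ d ∈ range (i + 1), T d := by
    rw [← sum_range_reflect]
    apply sum_congr rfl
    intro j hj
    rw [mem_range] at hj
    congr 1
    omega
  have h2 : ∑ j ∈ range r, T ((i - (i + 1 + j)) + ((i + 1 + j) - i)) = ∑ d ∈ range r, T (d + 1) := by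
    apply sum_congr rfl
    intro j hj
    congr 1
    omega
  rw [h1, h2, sum_range_succ']
  have := hP i
  have := hP r
  linarith

open Matrix in
lemma quad_nonneg (T : ℕ → ℝ) (hT : ∀ d, T (d + 1) ≤ 0)
    (hP : ∀ n, 0 ≤ T 0 / 2 + ∑ d ∈ Finset.range n, T (d + 1)) (N : ℕ)
    (S : Matrix (Fin N) (Fin N) ℝ) (hS : ∀ i j : Fin N, S i j = T ((i - j : ℕ) + (j - i : ℕ)))
    (x : Fin N → ℝ) : 0 ≤ x ⬝ᵥ (S *ᵥ x) := by
  have key : ∀ i j : Fin N, (S i j * x i ^ 2 + S i j * x j ^ 2) / 2 ≤ x i * (S i j * x j) := by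
    intro i j
    by_cases h : i = j
    · subst h; apply le_of_eq; ring
    · have : S i j ≤ 0 := by
        rw [hS]
        have h' : (i : ℕ) ≠ j := fun h' => h (Fin.ext h')
        obtain ⟨d, hd⟩ : ∃ d, ((i - j : ℕ) + (j - i : ℕ)) = d + 1 := 
          ⟨((i - j : ℕ) + (j - i : ℕ)) - 1, by omega⟩
        rw [hd]; exact hT d
      nlinarith [mul_nonneg (neg_nonneg.2 this) (sq_nonneg (x i - x j))]
  have hsym : ∀ i j, S i j = S j i := by
    intro i j; rw [hS, hS, add_comm]
  have hrow : ∀ i, 0 ≤ ∑ j, S i j := by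
    intro i
    have := row_nonneg T hP i N i.2
    rw [Finset.sum_range] at this
    simpa only [hS] using this
  have e1 : x ⬝ᵥ (S *ᵥ x) = ∑ i, ∑ j, x i * (S i j * x j) := by
    simp only [dotProduct, mulVec, Finset.mul_sum]
  rw [e1]
  have e2 : ∑ i, ∑ j, (S i j * x i ^ 2 + S i j * x j ^ 2) / 2 = ∑ i, (∑ j, S i j) * x i ^ 2 := by
    have a : ∑ i, ∑ j, S i j * x j ^ 2 = ∑ i, ∑ j, S i j * x i ^ 2 := by
      rw [Finset.sum_comm]
      refine Finset.sum_congr rfl fun i _ => Finset.sum_congr rfl fun j _ => ?_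
      rw [hsym]
    simp only [← Finset.sum_div, Finset.sum_add_distrib]
    rw [a]
    simp only [Finset.sum_mul]
    ring
  calc 0 ≤ ∑ i, (∑ j, S i j) * x i ^ 2 :=
        Finset.sum_nonneg fun i _ => mul_nonneg (hrow i) (sq_nonneg _)
    _ = _ := e2.symm
    _ ≤ _ := Finset.sum_le_sum fun i _ => Finset.sum_le_sum fun j _ => key i j

noncomputable def Tw (γ : ℝ) : ℕ → ℝ
  | 0 => 2 * w γ 1
  | 1 => w γ 0 + w γ 2
  | d + 2 => w γ (d + 3)

lemma S_eq (γ : ℝ) (m : ℕ) (i j : Fin (m - 1)) :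
    (wsgdMatrix γ m + Matrix.transpose (wsgdMatrix γ m)) i j
      = Tw γ ((i - j : ℕ) + (j - i : ℕ)) := by
  simp only [Matrix.add_apply, Matrix.transpose_apply, wsgdMatrix]
  generalize (i : ℕ) = a
  generalize (j : ℕ) = b
  have main : ∀ a d : ℕ, ((if a + d ≤ a + 1 then w γ (a + 1 - (a + d)) else 0)
      + (if a ≤ a + d + 1 then w γ (a + d + 1 - a) else 0)) = Tw γ d := by
    intro a d
    rw [if_pos (by omega : a ≤ a + d + 1), show a + d + 1 - a = d + 1 by omega]
    match d with
    | 0 => simp [Tw]; ring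
    | 1 => simp [Tw]
    | d + 2 => rw [if_neg (by omega)]; simp [Tw]
  rcases le_total a b with h | h
  · obtain ⟨d, rfl⟩ := Nat.exists_eq_add_of_le h
    rw [main, show a - (a + d) + (a + d - a) = d by omega]
  · obtain ⟨d, rfl⟩ := Nat.exists_eq_add_of_le h
    rw [add_comm, main, show b + d - b + (b - (b + d)) = d by omega]

lemma g_shift (γ : ℝ) (k : ℕ) : ((k : ℝ) + 1) * g γ (k + 1) = -γ * g (γ - 1) k := by
  induction k with
  | zero => simp [g]
  | succ k ih =>
    have h1 : ((k : ℝ) + 1) ≠ 0 := by positivity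
    have h2 : ((k : ℝ) + 1 + 1) ≠ 0 := by positivity
    have e1 : g γ (k + 1 + 1) = (1 - (γ + 1) / ((k : ℝ) + 1 + 1)) * g γ (k + 1) := by
      rw [g]; push_cast; ring
    have e2 : g (γ - 1) (k + 1) = (1 - γ / ((k : ℝ) + 1)) * g (γ - 1) k := by
      rw [g]; ring
    rw [e1, e2]
    push_cast
    have e3 : g γ (k + 1) = -γ * g (γ - 1) k / ((k : ℝ) + 1) := by
      rw [← ih]; field_simp
    rw [e3]; field_simp; ring

lemma G_succ (γ : ℝ) (k : ℕ) : g (γ - 1) (k + 1) = g (γ - 1) k + g γ (k + 1) := by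
  have h1 : ((k : ℝ) + 1) ≠ 0 := by positivity
  have e2 : g (γ - 1) (k + 1) = (1 - γ / ((k : ℝ) + 1)) * g (γ - 1) k := by
    rw [g]; ring
  have e3 : g γ (k + 1) = -γ * g (γ - 1) k / ((k : ℝ) + 1) := by
    rw [← g_shift]; field_simp
  rw [e2, e3]; field_simp; ring

lemma P_eq (γ : ℝ) (n : ℕ) : Tw γ 0 / 2 + ∑ d ∈ Finset.range (n + 1), Tw γ (d + 1)
    = γ / 2 * g (γ - 1) (n + 2) + (2 - γ) / 2 * g (γ - 1) (n + 1) := by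
  induction n with
  | zero => simp [Tw, w, g]; ring
  | succ n ih =>
    rw [Finset.sum_range_succ, ← add_assoc, ih, G_succ γ (n + 2), G_succ γ (n + 1)]
    simp only [Tw, w]
    ring

lemma g_rec (γ : ℝ) (k : ℕ) : g γ (k + 1) = (1 - (γ + 1) / ((k : ℝ) + 1)) * g γ k := by rw [g]

lemma alpha_g (γ : ℝ) (h0 : 0 < γ) (h1 : γ < 1) (k : ℕ) : g γ (k + 1) ≤ 0 := by
  induction k with
  | zero => simp [g]; linarith
  | succ k ih =>
    rw [g_rec]
    apply mul_nonpos_of_nonneg_of_nonpos _ ih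
    rw [sub_nonneg, div_le_one (by positivity)]
    push_cast
    have : (0 : ℝ) ≤ k := by positivity
    linarith

lemma alpha_G (γ : ℝ) (h1 : γ < 1) (k : ℕ) : 0 ≤ g (γ - 1) k := by
  induction k with
  | zero => simp [g]
  | succ k ih =>
    rw [g_rec]
    apply mul_nonneg _ ih
    rw [sub_nonneg, div_le_one (by positivity)]
    have : (0 : ℝ) ≤ k := by positivity
    linarith

lemma beta_g (γ : ℝ) (h0 : 1 < γ) (h1 : γ ≤ 2) (k : ℕ) : 0 ≤ g γ (k + 2) := by
  induction k with
  | zero => simp [g]; nlinarith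
  | succ k ih =>
    rw [g_rec]
    apply mul_nonneg _ ih
    rw [sub_nonneg, div_le_one (by positivity)]
    push_cast
    have : (0 : ℝ) ≤ k := by positivity
    linarith

lemma beta_G (γ : ℝ) (h0 : 1 < γ) (h1 : γ ≤ 2) (k : ℕ) : g (γ - 1) (k + 1) ≤ 0 := by
  induction k with
  | zero => simp [g]; linarith
  | succ k ih =>
    rw [g_rec]
    apply mul_nonpos_of_nonneg_of_nonpos _ ih
    rw [sub_nonneg, div_le_one (by positivity)]
    push_cast
    have : (0 : ℝ) ≤ k := by positivity
    linarith

open Matrix in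
lemma alpha_quad (γ : ℝ) (h0 : 0 < γ) (h1 : γ < 1) (m : ℕ) (x : Fin (m - 1) → ℝ) :
    0 ≤ x ⬝ᵥ ((wsgdMatrix γ m + (wsgdMatrix γ m)ᵀ) *ᵥ x) := by
  refine quad_nonneg (Tw γ) ?_ ?_ _ _ (S_eq γ m) x
  · rintro (_ | d)
    · simp only [Tw, w, g]; norm_num
      nlinarith [mul_pos h0 (sub_pos.2 h1), mul_pos (mul_pos h0 h0) (sub_pos.2 h1)]
    · simp only [Tw, w]
      nlinarith [alpha_g γ h0 h1 (d + 2), alpha_g γ h0 h1 (d + 1)]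
  · rintro (_ | n)
    · simp [Tw, w, g]; nlinarith
    · rw [P_eq]
      have := alpha_G γ h1 (n + 2)
      have := alpha_G γ h1 (n + 1)
      have : 0 ≤ 2 - γ := by linarith
      positivity

open Matrix in
lemma beta_quad (γ : ℝ) (h0 : 1 < γ) (h1 : γ ≤ 2) (m : ℕ) (x : Fin (m - 1) → ℝ) :
    x ⬝ᵥ ((wsgdMatrix γ m + (wsgdMatrix γ m)ᵀ) *ᵥ x) ≤ 0 := by
  have := quad_nonneg (fun d => - Tw γ d) ?_ ?_ _ (-(wsgdMatrix γ m + (wsgdMatrix γ m)ᵀ)) ?_ x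
  · rw [neg_mulVec, dotProduct_neg] at this; linarith
  · rintro (_ | d)
    · simp only [Tw, w, g]; norm_num
      nlinarith [mul_pos (sub_pos.2 h0) (by linarith : 0 < γ), mul_pos (mul_pos (sub_pos.2 h0) (by linarith : 0 < γ)) (by linarith : 0 < γ)]
    · simp only [Tw, w]
      nlinarith [beta_g γ h0 h1 (d + 1), mul_nonneg (sub_nonneg.2 h1) (beta_g γ h0 h1 d), mul_nonneg (by linarith : 0 ≤ γ) (beta_g γ h0 h1 (d+1))]
  · rintro (_ | n)
    · simp [Tw, w, g]; nlinarith
    · have e := P_eq γ n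
      simp only [Finset.sum_neg_distrib]
      nlinarith [mul_nonneg (sub_nonneg.2 h1) (neg_nonneg.2 (beta_G γ h0 h1 n)), mul_nonneg (by linarith : 0 ≤ γ) (neg_nonneg.2 (beta_G γ h0 h1 (n+1)))]
  · intro i j
    rw [Matrix.neg_apply, S_eq]

open Matrix in
lemma step_le {N : ℕ} (D : Matrix (Fin N) (Fin N) ℝ) (hD : ∀ x, 0 ≤ x ⬝ᵥ (D *ᵥ x))
    (x : Fin N → ℝ) :
    (((1 + D)⁻¹ * (1 - D)) *ᵥ x) ⬝ᵥ (((1 + D)⁻¹ * (1 - D)) *ᵥ x) ≤ x ⬝ᵥ x := by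
  by_cases h : IsUnit (1 + D).det
  · set y := ((1 + D)⁻¹ * (1 - D)) *ᵥ x with hy
    have e : (1 + D) *ᵥ y = (1 - D) *ᵥ x := by
      rw [hy, mulVec_mulVec, ← Matrix.mul_assoc, Matrix.mul_nonsing_inv _ h, Matrix.one_mul]
    rw [add_mulVec, sub_mulVec, one_mulVec, one_mulVec] at e
    have e2 : D *ᵥ (x + y) = x - y := by
      rw [mulVec_add]
      ext i
      have := congrFun e i
      simp only [Pi.add_apply, Pi.sub_apply] at this ⊢
      linarith
    have := hD (x + y)
    rw [e2, add_dotProduct, dotProduct_sub, dotProduct_sub, dotProduct_comm y x] at this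
    linarith
  · rw [Matrix.nonsing_inv_apply_not_isUnit _ h]
    simp only [Matrix.zero_mul, zero_mulVec, dotProduct_zero]
    exact Finset.sum_nonneg fun i _ => mul_self_nonneg _

theorem stmt_19 (α β μα μβ : ℝ) (hα0 : 0 < α) (hα1 : α < 1) (hβ1 : 1 < β) (hβ2 : β ≤ 2)
    (hμα : 0 ≤ μα) (hμβ : μβ < 0) (m : ℕ) (hm : 2 ≤ m) :
    ∀ (E : EuclideanSpace ℝ (Fin (m - 1))) (n : ℕ),
      ‖Matrix.toEuclideanCLM (𝕜 := ℝ) (n := Fin (m - 1))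
          (((1 + matD α β μα μβ m)⁻¹ * (1 - matD α β μα μβ m)) ^ n) E‖ ≤ ‖E‖ := by
  have hD : ∀ x, 0 ≤ x ⬝ᵥ ((matD α β μα μβ m).mulVec x) := by
    intro x
    have ha := mul_nonneg hμα (alpha_quad α hα0 hα1 m x)
    have hb := mul_nonneg_of_nonpos_of_nonpos hμβ.le (beta_quad β hβ1 hβ2 m x)
    rw [matD, Matrix.add_mulVec, Matrix.smul_mulVec, Matrix.smul_mulVec, dotProduct_add,
      dotProduct_smul, dotProduct_smul, smul_eq_mul, smul_eq_mul]
    linarith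
  intro E n
  induction n with
  | zero => simp
  | succ n ih =>
    refine le_trans ?_ ih
    rw [pow_succ', map_mul, ContinuousLinearMap.mul_apply]
    generalize (Matrix.toEuclideanCLM (𝕜 := ℝ) (n := Fin (m - 1))
          (((1 + matD α β μα μβ m)⁻¹ * (1 - matD α β μα μβ m)) ^ n)) E = F
    have := step_le _ hD F.ofLp
    rw [EuclideanSpace.norm_eq, EuclideanSpace.norm_eq]
    apply Real.sqrt_le_sqrt
    simp only [Real.norm_eq_abs, sq_abs, Matrix.ofLp_toEuclideanCLM]
    simpa only [dotProduct, ← sq] using this
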